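/- The relation ≤! on ℚ ∩ (−1,0] is a linear order: it is reflexive, transitive, antisymmetric, and any two rationals in (−1,0] are comparable. -/

import Mathlib

/-- The recursive order `≤!` on `Z_{n!}`, expressed on indices: `recLE n k l` means
`-k/n! ≤! -l/n!`. -/
def recLE : ℕ → ℕ → ℕ → Prop
  | 0, _, _ => True
  | 1, _, _ => True
  | (n + 2), k, l =>
      l % (n + 2) < k % (n + 2) ∨
      (k % (n + 2) = l % (n + 2) ∧ recLE (n + 1) (k / (n + 2)) (l / (n + 2)))

/-- Every rational is cleared to an integer by some factorial `n!` with `n ≥ 1`. -/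
lemma exists_factorial_clear (x : ℚ) :
    ∃ n : ℕ, 1 ≤ n ∧ ∃ z : ℤ, ((n.factorial : ℚ) * x) = (z : ℚ) := by
  obtain ⟨c, hc⟩ := Nat.dvd_factorial x.den_pos (le_refl x.den)
  refine ⟨x.den, x.den_pos, ⟨c * x.num, ?_⟩⟩
  have hden : (x.den : ℚ) ≠ 0 := by exact_mod_cast x.den_pos.ne'
  have hx : (x.den : ℚ) * x = (x.num : ℚ) := by
    rw [mul_comm, Rat.mul_den_eq_num]
  rw [hc]
  push_cast
  rw [mul_comm (x.den : ℚ) (c : ℚ), mul_assoc, hx]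

/-- `nIdx x` is the least `n ≥ 1` such that `n! · x` is an integer
(the denominator of the normal factorial form of `x`). -/
noncomputable def nIdx (x : ℚ) : ℕ :=
  @Nat.find (fun n => 1 ≤ n ∧ ∃ z : ℤ, ((n.factorial : ℚ) * x) = (z : ℚ))
    (Classical.decPred _) (exists_factorial_clear x)

/-- `pIdx x` is the numerator `p` of the normal factorial form `x = -p/(nIdx x)!`. -/
noncomputable def pIdx (x : ℚ) : ℕ :=
  (-(((nIdx x).factorial : ℚ) * x)).num.toNat

/-- The order `≤!` on `ℚ ∩ (-1, 0]`, via normal factorial forms. -/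
noncomputable def qLE (x y : ℚ) : Prop :=
  nIdx y < nIdx x ∨ (nIdx x = nIdx y ∧ recLE (nIdx x) (pIdx x) (pIdx y))

theorem recLE_refl : ∀ n k : ℕ, recLE n k k
  | 0, _ => trivial
  | 1, _ => trivial
  | n + 2, k => Or.inr ⟨rfl, recLE_refl (n + 1) (k / (n + 2))⟩

theorem recLE_trans : ∀ n {k l m : ℕ}, recLE n k l → recLE n l m → recLE n k m
  | 0, _, _, _, _, _ => trivial
  | 1, _, _, _, _, _ => trivial
  | n + 2, k, l, m, hkl, hlm => by
    rcases hkl with hkl | ⟨ekl, hkl⟩ <;> rcases hlm with hlm | ⟨elm, hlm⟩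
    · exact Or.inl (hlm.trans hkl)
    · exact Or.inl (elm ▸ hkl)
    · exact Or.inl (ekl.symm ▸ hlm)
    · exact Or.inr ⟨ekl.trans elm, recLE_trans (n + 1) hkl hlm⟩

theorem recLE_total : ∀ n k l : ℕ, recLE n k l ∨ recLE n l k
  | 0, _, _ => Or.inl trivial
  | 1, _, _ => Or.inl trivial
  | n + 2, k, l => by
    rcases lt_trichotomy (l % (n + 2)) (k % (n + 2)) with h | h | h
    · exact Or.inl (Or.inl h)
    · exact (recLE_total (n + 1) (k / (n + 2)) (l / (n + 2))).imp
        (fun H => Or.inr ⟨h.symm, H⟩) (fun H => Or.inr ⟨h, H⟩)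
    · exact Or.inr (Or.inl h)

theorem recLE_antisymm : ∀ n {k l : ℕ}, k < n.factorial → l < n.factorial →
    recLE n k l → recLE n l k → k = l
  | 0, k, l, hk, hl, _, _ => by simp at hk hl; omega
  | 1, k, l, hk, hl, _, _ => by simp at hk hl; omega
  | n + 2, k, l, hk, hl, hkl, hlk => by
    rcases hkl with hkl | ⟨e, hkl⟩ <;> rcases hlk with hlk | ⟨e', hlk⟩
    · omega
    · omega
    · omega
    · rw [Nat.factorial_succ] at hk hl
      have h := recLE_antisymm (n + 1) (Nat.div_lt_of_lt_mul hk) (Nat.div_lt_of_lt_mul hl) hkl hlk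
      rw [← Nat.div_add_mod k (n + 2), ← Nat.div_add_mod l (n + 2), h, e]

theorem nIdx_spec (x : ℚ) : ∃ z : ℤ, ((nIdx x).factorial : ℚ) * x = z :=
  (@Nat.find_spec _ (Classical.decPred _) (exists_factorial_clear x)).2

theorem pIdx_cast {x : ℚ} (hx : x ≤ 0) : (pIdx x : ℚ) = -((nIdx x).factorial * x) := by
  obtain ⟨z, hz⟩ := nIdx_spec x
  have hz0 : z ≤ 0 := by
    have : (z : ℚ) ≤ 0 := hz ▸ mul_nonpos_of_nonneg_of_nonpos (Nat.cast_nonneg _) hx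
    exact_mod_cast this
  have hp : ((pIdx x : ℕ) : ℤ) = -z := by
    rw [pIdx, hz, ← Int.cast_neg, Rat.num_intCast, Int.toNat_of_nonneg (by omega)]
  rw [hz]
  exact_mod_cast congrArg (Int.cast : ℤ → ℚ) hp

theorem pIdx_lt {x : ℚ} (hx : -1 < x) (hx0 : x ≤ 0) : pIdx x < (nIdx x).factorial := by
  have hf : (0 : ℚ) < (nIdx x).factorial := by exact_mod_cast Nat.factorial_pos _
  have : (pIdx x : ℚ) < (nIdx x).factorial := by
    rw [pIdx_cast hx0]
    nlinarith
  exact_mod_cast this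

theorem eq_of_nIdx_eq_of_pIdx_eq {x y : ℚ} (hx : x ≤ 0) (hy : y ≤ 0)
    (hn : nIdx x = nIdx y) (hp : pIdx x = pIdx y) : x = y := by
  have h : (pIdx x : ℚ) = pIdx y := congrArg _ hp
  rw [pIdx_cast hx, pIdx_cast hy, hn, neg_inj] at h
  exact mul_left_cancel₀ (by exact_mod_cast Nat.factorial_ne_zero _) h

theorem stmt5 :
    -- reflexive
    (∀ x : ℚ, -1 < x → x ≤ 0 → qLE x x) ∧
    -- transitive
    (∀ x y z : ℚ, -1 < x → x ≤ 0 → -1 < y → y ≤ 0 → -1 < z → z ≤ 0 →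
      qLE x y → qLE y z → qLE x z) ∧
    -- antisymmetric
    (∀ x y : ℚ, -1 < x → x ≤ 0 → -1 < y → y ≤ 0 → qLE x y → qLE y x → x = y) ∧
    -- total
    (∀ x y : ℚ, -1 < x → x ≤ 0 → -1 < y → y ≤ 0 → qLE x y ∨ qLE y x) := by
  refine ⟨fun x _ _ => Or.inr ⟨rfl, recLE_refl _ _⟩, ?_, ?_, ?_⟩
  · rintro x y z - - - - - - (hxy | ⟨exy, hxy⟩) (hyz | ⟨eyz, hyz⟩)
    · exact Or.inl (hyz.trans hxy)
    · exact Or.inl (eyz ▸ hxy)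
    · exact Or.inl (exy.symm ▸ hyz)
    · exact Or.inr ⟨exy.trans eyz, recLE_trans _ hxy (exy.symm ▸ hyz)⟩
  · rintro x y hx hx0 hy hy0 (hxy | ⟨exy, hxy⟩) (hyx | ⟨eyx, hyx⟩)
    · omega
    · omega
    · omega
    · exact eq_of_nIdx_eq_of_pIdx_eq hx0 hy0 exy
        (recLE_antisymm _ (pIdx_lt hx hx0) (exy ▸ pIdx_lt hy hy0) hxy (exy.symm ▸ hyx))
  · intro x y _ _ _ _
    rcases lt_trichotomy (nIdx y) (nIdx x) with h | h | h
    · exact Or.inl (Or.inl h)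
    · exact (recLE_total (nIdx x) (pIdx x) (pIdx y)).imp
        (fun H => Or.inr ⟨h.symm, H⟩) (fun H => Or.inr ⟨h, h.symm ▸ H⟩)
    · exact Or.inr (Or.inl h)
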